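/- Let 0 < η < ν < 1, μ = 1 − ν, α > 0, and let (C_N) be a sequence of integers with C_N = ηN + O(1). Then lim_{N→∞} exp(α·√N·log(ν/(ν−η))) · [∫₀^{√N} (1 − u/√N)^N u^{α√N−1} du] / [∫₀^{√N} (1 − u/√N)^{N−C_N} (1 + (μ/ν)·u/√N)^{C_N} u^{α√N−1} du] = exp(η(1−η)·α²/(2(ν−η)²)). -/

import Mathlib

open Filter Topology MeasureTheory Asymptotics

lemma aux_int (s r : ℝ) (hs : 0 < s) (hr : 0 < r) :
    IntegrableOn (fun v : ℝ => v ^ (s-1) * Real.exp (-(r*v))) (Set.Ioi 0) := by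
  by_contra h
  have h1 := Real.integral_rpow_mul_exp_neg_mul_Ioi hs hr
  rw [integral_undef h] at h1
  have : 0 < (1 / r) ^ s * Real.Gamma s := mul_pos (Real.rpow_pos_of_pos (by positivity) _) (Real.Gamma_pos_of_pos hs)
  linarith

/-- second moment about the mean -/
lemma aux_var (α r : ℝ) (hα : 0 < α) (hr : 0 < r) :
    IntegrableOn (fun v : ℝ => (v - α)^2 * (v ^ (α*r-1) * Real.exp (-(r*v)))) (Set.Ioi 0) ∧
    ∫ v in Set.Ioi (0:ℝ), (v - α)^2 * (v ^ (α*r-1) * Real.exp (-(r*v))) =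
      α / r * ((1 / r) ^ (α*r) * Real.Gamma (α*r)) := by
  have hs : 0 < α * r := by positivity
  have e : Set.EqOn (fun v : ℝ => (v - α)^2 * (v ^ (α*r-1) * Real.exp (-(r*v))))
      (fun v : ℝ => v ^ (α*r+2-1) * Real.exp (-(r*v)) - 2 * α * (v ^ (α*r+1-1) * Real.exp (-(r*v)))
        + α^2 * (v ^ (α*r-1) * Real.exp (-(r*v)))) (Set.Ioi 0) := by
    intro v hv
    have hv : 0 < v := hv
    have h1 : v ^ (α*r+1-1) = v * v ^ (α*r-1) := by
      rw [show α*r+1-1 = 1 + (α*r-1) by ring, Real.rpow_add hv, Real.rpow_one]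
    have h2 : v ^ (α*r+2-1) = v^2 * v ^ (α*r-1) := by
      rw [show α*r+2-1 = 2 + (α*r-1) by ring, Real.rpow_add hv, Real.rpow_two]
    simp only [h1, h2]; ring
  have i0 := aux_int (α*r) r hs hr
  have i1 := aux_int (α*r+1) r (by positivity) hr
  have i2 := aux_int (α*r+2) r (by positivity) hr
  have i12 : IntegrableOn (fun v : ℝ => v ^ (α*r+2-1) * Real.exp (-(r*v)) -
      2 * α * (v ^ (α*r+1-1) * Real.exp (-(r*v)))) (Set.Ioi 0) := i2.sub (i1.const_mul (2*α))
  refine ⟨(i12.add (i0.const_mul (α^2))).congr_fun e.symm measurableSet_Ioi, ?_⟩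
  rw [setIntegral_congr_fun measurableSet_Ioi e]
  rw [integral_add i12 (i0.const_mul (α^2)), integral_sub i2 (i1.const_mul (2*α)),
    integral_const_mul, integral_const_mul, Real.integral_rpow_mul_exp_neg_mul_Ioi hs hr,
    Real.integral_rpow_mul_exp_neg_mul_Ioi (by positivity) hr,
    Real.integral_rpow_mul_exp_neg_mul_Ioi (by positivity) hr,
    show α*r+2 = α*r+1+1 by ring, Real.Gamma_add_one (by positivity), Real.Gamma_add_one hs.ne',
    Real.rpow_add (by positivity), Real.rpow_add (by positivity), Real.rpow_one]
  field_simp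
  ring

lemma aux_conc (α L M : ℝ) (hα : 0 < α) (r : ℕ → ℝ) (hr : Tendsto r atTop atTop)
    (g : ℕ → ℝ → ℝ) (hg : ∀ N, Measurable (g N))
    (hM : ∀ᶠ N in atTop, ∀ v, 0 < v → |g N v| ≤ M)
    (hL : Tendsto (fun p : ℕ × ℝ => g p.1 p.2) (atTop ×ˢ 𝓝 α) (𝓝 L)) :
    Tendsto (fun N => (∫ v in Set.Ioi (0:ℝ), g N v * (v ^ (α * r N - 1) * Real.exp (-(r N * v)))) /
      ((1 / r N) ^ (α * r N) * Real.Gamma (α * r N))) atTop (𝓝 L) := by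
  rw [Metric.tendsto_nhds]
  intro ε hε
  have h1 := (Metric.tendsto_nhds.1 hL) (ε/2) (by positivity)
  rw [Filter.eventually_prod_iff] at h1
  obtain ⟨p, hp, q, hq, hpq⟩ := h1
  obtain ⟨δ, hδ, hq⟩ := Metric.eventually_nhds_iff.1 hq
  have h3 : Tendsto (fun N => (|M|+|L|)/δ^2 * (α / r N)) atTop (𝓝 ((|M|+|L|)/δ^2 * 0)) :=
    (hr.const_div_atTop α).const_mul _
  rw [mul_zero] at h3
  filter_upwards [hp, hM, hr.eventually_gt_atTop 0, h3.eventually_lt_const (show 0 < ε/2 by positivity)] with N hpN hMN hrN h3N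
  set m := (1 / r N) ^ (α * r N) * Real.Gamma (α * r N) with hm
  have hmpos : 0 < m := mul_pos (Real.rpow_pos_of_pos (by positivity) _) (Real.Gamma_pos_of_pos (by positivity))
  set w : ℝ → ℝ := fun v => v ^ (α * r N - 1) * Real.exp (-(r N * v)) with hw
  have hwi : IntegrableOn w (Set.Ioi 0) := aux_int _ _ (by positivity) hrN
  have hwm : ∫ v in Set.Ioi 0, w v = m := Real.integral_rpow_mul_exp_neg_mul_Ioi (by positivity) hrN
  obtain ⟨hvi, hv⟩ := aux_var α (r N) hα hrN
  have hgi : IntegrableOn (fun v => g N v * w v) (Set.Ioi 0) := by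
    refine Integrable.bdd_mul (c := M) hwi (hg N).aestronglyMeasurable ?_
    exact (ae_restrict_iff' measurableSet_Ioi).2 (ae_of_all _ fun v hv => hMN v hv)
  have hb : ∀ v ∈ Set.Ioi (0:ℝ), ‖g N v * w v - L * w v‖ ≤ ε/2 * w v + (|M|+|L|)/δ^2 * ((v-α)^2 * w v) := by
    intro v hv
    have hv : 0 < v := hv
    have hwv : 0 ≤ w v := by positivity
    rw [← sub_mul, norm_mul, Real.norm_of_nonneg hwv]
    generalize w v = z at hwv ⊢
    rw [← mul_assoc, ← add_mul]
    refine mul_le_mul_of_nonneg_right ?_ hwv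
    by_cases hd : dist v α < δ
    · have := hpq hpN (hq hd)
      rw [Real.dist_eq] at this
      rw [Real.norm_eq_abs]
      have : 0 ≤ (|M|+|L|)/δ^2 * (v-α)^2 := by positivity
      linarith
    · rw [Real.dist_eq, not_lt] at hd
      have h1 : δ^2 ≤ (v-α)^2 := by rw [← sq_abs (v-α)]; gcongr
      have h2 : ‖g N v - L‖ ≤ |M| + |L| := by
        refine (norm_sub_le _ _).trans ?_
        have := hMN v hv
        have := le_abs_self M
        simp only [Real.norm_eq_abs]; linarith
      have h3 : |M| + |L| ≤ (|M|+|L|)/δ^2 * (v-α)^2 := by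
        rw [div_mul_eq_mul_div, le_div_iff₀ (by positivity)]
        gcongr
      linarith
  have hI : ‖∫ v in Set.Ioi (0:ℝ), (g N v * w v - L * w v)‖ ≤ ε/2 * m + (|M|+|L|)/δ^2 * (α / r N * m) := by
    rw [← hwm, ← integral_const_mul]
    rw [hwm, hm, ← hv, ← integral_const_mul]
    rw [← integral_add (hwi.const_mul _) (hvi.const_mul _)]
    refine norm_integral_le_of_norm_le ((hwi.const_mul _).add (hvi.const_mul _)) ?_
    exact (ae_restrict_iff' measurableSet_Ioi).2 (ae_of_all _ hb)
  rw [integral_sub hgi (hwi.const_mul L), integral_const_mul, hwm] at hI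
  rw [Real.dist_eq]
  change |(∫ v in Set.Ioi 0, g N v * w v) / m - L| < ε
  rw [div_sub' hmpos.ne', abs_div, abs_of_pos hmpos, div_lt_iff₀ hmpos, mul_comm m L]
  refine hI.trans_lt ?_
  have : ((|M|+|L|)/δ^2 * (α / r N)) * m < ε/2 * m := by gcongr
  nlinarith

lemma aux_log : ∃ φ : ℝ → ℝ, Tendsto φ (𝓝 0) (𝓝 (-1/2)) ∧ ∀ x, Real.log (1 + x) = x + x^2 * φ x := by
  refine ⟨fun x => if x = 0 then -1/2 else (Real.log (1+x) - x)/x^2, ?_, ?_⟩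
  · have h0 : Tendsto (fun x : ℝ => |x| / (1 - |x|)) (𝓝 0) (𝓝 0) := by
      have : ContinuousAt (fun x : ℝ => |x| / (1 - |x|)) 0 := by
        apply ContinuousAt.div <;> first | fun_prop | simp
      simpa [ContinuousAt] using this
    rw [tendsto_iff_dist_tendsto_zero]
    refine squeeze_zero' (Eventually.of_forall fun x => dist_nonneg) ?_ h0
    filter_upwards [Metric.ball_mem_nhds (0:ℝ) one_pos] with x hx
    have hx : |x| < 1 := by simpa using hx
    split_ifs with h
    · simp [h]
    · have := Real.abs_log_sub_add_sum_range_le (x := -x) (by simpa using hx) 2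
      simp only [Finset.sum_range_succ, Finset.sum_range_zero, abs_neg] at this
      norm_num at this
      have e : (Real.log (1+x) - x)/x^2 - -1/2 = (-x + x^2/2 + Real.log (1+x))/x^2 := by
        field_simp; ring
      rw [Real.dist_eq, e, abs_div, abs_of_pos (show 0 < x^2 by positivity), div_le_iff₀ (by positivity)]
      refine this.trans (le_of_eq ?_)
      rw [← sq_abs x]; ring
  · intro x
    dsimp only
    split_ifs with h
    · simp [h]
    · field_simp; ring

/-- The integrand after division by the Gamma weight. -/
noncomputable def auxG (a d : ℝ) (A C : ℕ → ℕ) (N : ℕ) (v : ℝ) : ℝ :=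
  (Set.Iio (Real.sqrt N)).indicator (fun u => (1 - u / Real.sqrt N) ^ A N *
    (1 + d * u / Real.sqrt N) ^ C N) (a * v) * Real.exp (Real.sqrt N * v)

lemma auxG_meas (a d : ℝ) (A C : ℕ → ℕ) (N : ℕ) : Measurable (auxG a d A C N) := by
  unfold auxG
  refine Measurable.mul ?_ (by fun_prop)
  refine Measurable.comp (g := (Set.Iio (Real.sqrt N)).indicator (fun u => (1 - u / Real.sqrt N) ^ A N *
    (1 + d * u / Real.sqrt N) ^ C N)) ?_ (by fun_prop)
  exact Measurable.indicator (by fun_prop) measurableSet_Iio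

lemma aux_lin (a d η K : ℝ) (ha : 0 < a) (hd : 0 ≤ d) (hb : a * ((1 - η) - d * η) = 1)
    (n A C : ℝ) (hA : |A - (1 - η) * n| ≤ K) (hC : |C - η * n| ≤ K) :
    |n - a * A + a * d * C| ≤ a * K + a * d * K := by
  have : n - a * A + a * d * C = a * (-(A - (1-η)*n)) + a * d * (C - η * n) := by
    linear_combination (-n) * hb
  rw [this]
  refine (abs_add_le _ _).trans ?_
  rw [abs_mul, abs_mul, abs_neg, abs_of_pos ha, abs_of_nonneg (show 0 ≤ a * d by positivity)]
  gcongr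

lemma auxG_bound (a d η K : ℝ) (ha : 0 < a) (hd : 0 ≤ d) (hb : a * ((1 - η) - d * η) = 1)
    (A C : ℕ → ℕ) (N : ℕ) (hN : 0 < N) (hA : |(A N : ℝ) - (1 - η) * N| ≤ K) (hC : |(C N : ℝ) - η * N| ≤ K)
    (v : ℝ) (hv : 0 < v) :
    |auxG a d A C N v| ≤ Real.exp (1 / a * (a * K + a * d * K)) := by
  unfold auxG
  have hn : 0 < Real.sqrt N := Real.sqrt_pos.2 (by exact_mod_cast hN)
  have hnn : Real.sqrt N * Real.sqrt N = N := Real.mul_self_sqrt (by positivity)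
  set n := Real.sqrt N
  by_cases h : a * v < n
  · rw [Set.indicator_of_mem (by exact h)]
    have hx : a * v / n < 1 := by rwa [div_lt_one hn]
    have h1 : (1 - a * v / n) ^ A N ≤ Real.exp (A N * (-(a * v / n))) := by
      rw [Real.exp_nat_mul]
      exact pow_le_pow_left₀ (by linarith) (Real.one_sub_le_exp_neg _) _
    have h2 : (1 + d * (a * v) / n) ^ C N ≤ Real.exp (C N * (d * (a * v) / n)) := by
      rw [Real.exp_nat_mul]
      refine pow_le_pow_left₀ (by positivity) ?_ _
      rw [add_comm]; exact Real.add_one_le_exp _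
    have h0 : 0 ≤ (1 - a * v / n) ^ A N := pow_nonneg (by linarith) _
    have h0' : 0 ≤ (1 + d * (a * v) / n) ^ C N := by positivity
    rw [abs_of_nonneg (by positivity)]
    calc _ ≤ Real.exp (A N * (-(a * v / n))) * Real.exp (C N * (d * (a * v) / n)) * Real.exp (n * v) := by
          gcongr
      _ = Real.exp (v / n * (N - a * A N + a * d * C N)) := by
          rw [← Real.exp_add, ← Real.exp_add, ← hnn]
          congr 1
          field_simp
          ring
      _ ≤ _ := by
          apply Real.exp_le_exp.2
          have h3 := aux_lin a d η K ha hd hb N (A N) (C N) hA hC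
          have h4 : v / n ≤ 1 / a := by
            rw [div_le_div_iff₀ hn ha]; linarith
          calc _ ≤ v / n * |N - a * A N + a * d * C N| := by gcongr; exact le_abs_self _
            _ ≤ _ := by gcongr
  · rw [Set.indicator_of_notMem (by exact h)]
    simp only [zero_mul, abs_zero]
    positivity

lemma aux_ratio (A : ℕ → ℕ) (θ K : ℝ) (hA : ∀ᶠ N : ℕ in atTop, |(A N : ℝ) - θ * N| ≤ K) :
    Tendsto (fun N : ℕ => (A N : ℝ) / N) atTop (𝓝 θ) := by
  rw [tendsto_iff_dist_tendsto_zero]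
  refine squeeze_zero' (Eventually.of_forall fun x => dist_nonneg) ?_
    (tendsto_const_div_atTop_nhds_zero_nat K)
  filter_upwards [hA, eventually_gt_atTop 0] with N h hN
  have hN : (0:ℝ) < N := by exact_mod_cast hN
  rw [Real.dist_eq, div_sub' hN.ne', abs_div, abs_of_pos hN, mul_comm (N:ℝ) θ]
  gcongr

lemma auxG_lim (α a d η K : ℝ) (hα : 0 < α) (ha : 0 < a) (hd : 0 ≤ d) (hb : a * ((1 - η) - d * η) = 1)
    (A C : ℕ → ℕ) (hA : ∀ᶠ N : ℕ in atTop, |(A N : ℝ) - (1 - η) * N| ≤ K)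
    (hC : ∀ᶠ N : ℕ in atTop, |(C N : ℝ) - η * N| ≤ K) :
    Tendsto (fun p : ℕ × ℝ => auxG a d A C p.1 p.2) (atTop ×ˢ 𝓝 α)
      (𝓝 (Real.exp (-(α ^ 2 * a ^ 2 / 2 * ((1 - η) + d ^ 2 * η))))) := by
  obtain ⟨φ, hφ, hlog⟩ := aux_log
  have hs : Tendsto (fun N : ℕ => Real.sqrt N) atTop atTop :=
    Real.tendsto_sqrt_atTop.comp tendsto_natCast_atTop_atTop
  have f1 : Tendsto (fun p : ℕ × ℝ => p.1) (atTop ×ˢ 𝓝 α) atTop := tendsto_fst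
  have f2 : Tendsto (fun p : ℕ × ℝ => p.2) (atTop ×ˢ 𝓝 α) (𝓝 α) := tendsto_snd
  have hn := hs.comp f1
  have hvn : Tendsto (fun p : ℕ × ℝ => p.2 / Real.sqrt p.1) (atTop ×ˢ 𝓝 α) (𝓝 0) := f2.div_atTop hn
  have hx1 : Tendsto (fun p : ℕ × ℝ => -(a * (p.2 / Real.sqrt p.1))) (atTop ×ˢ 𝓝 α) (𝓝 0) := by
    simpa using (hvn.const_mul a).neg
  have hx2 : Tendsto (fun p : ℕ × ℝ => d * (a * (p.2 / Real.sqrt p.1))) (atTop ×ˢ 𝓝 α) (𝓝 0) := by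
    simpa using (hvn.const_mul a).const_mul d
  have hlin : Tendsto (fun p : ℕ × ℝ => p.2 / Real.sqrt p.1 * ((p.1:ℝ) - a * A p.1 + a * d * C p.1))
      (atTop ×ˢ 𝓝 α) (𝓝 0) := by
    refine squeeze_zero_norm' (a := fun p : ℕ × ℝ => |p.2 / Real.sqrt p.1| * (a * K + a * d * K)) ?_ ?_
    · filter_upwards [f1.eventually hA, f1.eventually hC] with p h1 h2
      rw [norm_mul, Real.norm_eq_abs, Real.norm_eq_abs]
      gcongr
      exact aux_lin a d η K ha hd hb _ _ _ h1 h2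
    · simpa using hvn.abs.mul_const (a * K + a * d * K)
  have hAr := (aux_ratio A _ K hA).comp f1
  have hCr := (aux_ratio C _ K hC).comp f1
  have hq1 := (hAr.mul ((f2.pow 2).const_mul (a^2))).mul (hφ.comp hx1)
  have hq2 := (hCr.mul ((f2.pow 2).const_mul (d^2*a^2))).mul (hφ.comp hx2)
  have htot := (Real.continuous_exp.tendsto _).comp ((hlin.add hq1).add hq2)
  have e : 0 + (1 - η) * (a ^ 2 * α ^ 2) * (-1 / 2) + η * (d^2 * a ^ 2 * α ^ 2) * (-1 / 2) =
    -(α ^ 2 * a ^ 2 / 2 * ((1 - η) + d ^ 2 * η)) := by ring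
  rw [e] at htot
  refine htot.congr' ?_
  filter_upwards [f1.eventually (eventually_gt_atTop 0), f2.eventually (lt_mem_nhds hα),
    hx1.eventually (lt_mem_nhds (show (-1:ℝ) < 0 by norm_num))] with p hN hv hx
  obtain ⟨N, v⟩ := p
  simp only [Function.comp_apply] at *
  have hn : 0 < Real.sqrt N := Real.sqrt_pos.2 (by exact_mod_cast hN)
  have hnn : (N:ℝ) = Real.sqrt N ^ 2 := (Real.sq_sqrt (by positivity)).symm
  unfold auxG
  have hlt : a * v / Real.sqrt N < 1 := by rw [mul_div_assoc]; linarith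
  have h : a * v < Real.sqrt N := by rwa [div_lt_one hn] at hlt
  rw [Set.indicator_of_mem (by exact h)]
  have p1 : 0 < 1 + -(a * (v / Real.sqrt N)) := by linarith
  have p2 : 0 < 1 + d * (a * (v / Real.sqrt N)) := by positivity
  have e1 : (1 - a * v / Real.sqrt N) ^ A N =
      Real.exp (A N * (-(a * (v / Real.sqrt N)) + (-(a * (v / Real.sqrt N)))^2 * φ (-(a * (v / Real.sqrt N))))) := by
    rw [← hlog, Real.exp_nat_mul, Real.exp_log p1]
    congr 1; ring
  have e2 : (1 + d * (a * v) / Real.sqrt N) ^ C N =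
      Real.exp (C N * (d * (a * (v / Real.sqrt N)) + (d * (a * (v / Real.sqrt N)))^2 * φ (d * (a * (v / Real.sqrt N))))) := by
    rw [← hlog, Real.exp_nat_mul, Real.exp_log p2]
    congr 1; ring
  rw [e1, e2, ← Real.exp_add, ← Real.exp_add]
  congr 1
  generalize φ (-(a * (v / Real.sqrt N))) = y1
  generalize φ (d * (a * (v / Real.sqrt N))) = y2
  rw [hnn, Real.sqrt_sq hn.le]
  field_simp
  ring

lemma aux_subst (a d s : ℝ) (ha : 0 < a) (A C : ℕ → ℕ) (N : ℕ) :
    ∫ u in Set.Ioo (0:ℝ) (Real.sqrt N), (1 - u / Real.sqrt N) ^ A N *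
      (1 + d * u / Real.sqrt N) ^ C N * u ^ (s - 1) =
    a ^ s * ∫ v in Set.Ioi (0:ℝ), auxG a d A C N v * (v ^ (s-1) * Real.exp (-(Real.sqrt N * v))) := by
  set F : ℝ → ℝ := fun u => (Set.Iio (Real.sqrt N)).indicator (fun u => (1 - u / Real.sqrt N) ^ A N *
    (1 + d * u / Real.sqrt N) ^ C N) u * u ^ (s-1) with hF
  have h1 : ∫ u in Set.Ioo (0:ℝ) (Real.sqrt N), (1 - u / Real.sqrt N) ^ A N *
      (1 + d * u / Real.sqrt N) ^ C N * u ^ (s - 1) = ∫ u in Set.Ioi (0:ℝ), F u := by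
    rw [← Set.Ioi_inter_Iio, ← setIntegral_indicator measurableSet_Iio]
    congr 1
    ext u
    simp only [hF, Set.indicator]
    split_ifs <;> simp
  have h2 := integral_comp_mul_left_Ioi F 0 ha
  rw [mul_zero, smul_eq_mul] at h2
  have h3 : ∫ v in Set.Ioi (0:ℝ), F (a * v) = a ^ (s-1) * ∫ v in Set.Ioi (0:ℝ), auxG a d A C N v * (v ^ (s-1) * Real.exp (-(Real.sqrt N * v))) := by
    rw [← integral_const_mul]
    refine setIntegral_congr_fun measurableSet_Ioi fun v hv => ?_
    have hv : 0 < v := hv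
    simp only [hF, auxG]
    rw [Real.mul_rpow ha.le hv.le, Real.exp_neg]
    generalize (Set.Iio (Real.sqrt N)).indicator (fun u : ℝ => (1 - u / Real.sqrt N) ^ A N *
      (1 + d * u / Real.sqrt N) ^ C N) (a * v) = z
    field_simp
  rw [h1]
  have h4 : a ^ s = a * a ^ (s-1) := by
    rw [Real.rpow_sub_one ha.ne']; field_simp
  rw [h4, mul_assoc, ← h3, h2]
  field_simp

lemma aux_key (α a d η K : ℝ) (hα : 0 < α) (ha : 0 < a) (hd : 0 ≤ d) (hb : a * ((1 - η) - d * η) = 1)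
    (A C : ℕ → ℕ) (hA : ∀ᶠ N : ℕ in atTop, |(A N : ℝ) - (1 - η) * N| ≤ K)
    (hC : ∀ᶠ N : ℕ in atTop, |(C N : ℝ) - η * N| ≤ K) :
    Tendsto (fun N : ℕ => (∫ u in Set.Ioo (0:ℝ) (Real.sqrt N), (1 - u / Real.sqrt N) ^ A N *
      (1 + d * u / Real.sqrt N) ^ C N * u ^ (α * Real.sqrt N - 1)) / (a ^ (α * Real.sqrt N) *
        ((1 / Real.sqrt N) ^ (α * Real.sqrt N) * Real.Gamma (α * Real.sqrt N)))) atTop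
      (𝓝 (Real.exp (-(α ^ 2 * a ^ 2 / 2 * ((1 - η) + d ^ 2 * η))))) := by
  have hs : Tendsto (fun N : ℕ => Real.sqrt N) atTop atTop :=
    Real.tendsto_sqrt_atTop.comp tendsto_natCast_atTop_atTop
  have h := aux_conc α _ (Real.exp (1 / a * (a * K + a * d * K))) hα _ hs (auxG a d A C)
    (auxG_meas a d A C) (by
      filter_upwards [hA, hC, eventually_gt_atTop 0] with N h1 h2 h3 v hv
      exact auxG_bound a d η K ha hd hb A C N h3 h1 h2 v hv)
    (auxG_lim α a d η K hα ha hd hb A C hA hC)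
  refine h.congr fun N => ?_
  rw [aux_subst a d (α * Real.sqrt N) ha, mul_div_mul_left _ _ (Real.rpow_pos_of_pos ha _).ne']

/-- Super-critical regime: convergence of the Laplace transform of the centered and
rescaled hitting time of the boundary `C_N`, expressed as a ratio of integrals. -/
theorem supercritical_laplace_limit
    (η ν μ α : ℝ) (hη : 0 < η) (hην : η < ν) (hν : ν < 1) (hμ : μ = 1 - ν)
    (hα : 0 < α) (C : ℕ → ℕ)
    (hC : (fun N : ℕ => (C N : ℝ) - η * N) =O[atTop] fun _ : ℕ => (1 : ℝ)) :
    Tendsto (fun N : ℕ =>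
        Real.exp (α * Real.sqrt N * Real.log (ν / (ν - η))) *
          ((∫ u in Set.Ioo (0:ℝ) (Real.sqrt N),
              (1 - u / Real.sqrt N) ^ N * u ^ (α * Real.sqrt N - 1)) /
           (∫ u in Set.Ioo (0:ℝ) (Real.sqrt N),
              (1 - u / Real.sqrt N) ^ (N - C N) *
                (1 + (μ / ν) * u / Real.sqrt N) ^ (C N) *
                u ^ (α * Real.sqrt N - 1))))
      atTop (𝓝 (Real.exp (η * (1 - η) * α ^ 2 / (2 * (ν - η) ^ 2)))) := by
  obtain ⟨K, hK⟩ := hC.bound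
  have hC' : ∀ᶠ N : ℕ in atTop, |(C N : ℝ) - η * N| ≤ K := by
    filter_upwards [hK] with N h
    simpa using h
  have hν0 : 0 < ν := hη.trans hην
  have hνη : 0 < ν - η := sub_pos.2 hην
  have ha : 0 < ν / (ν - η) := by positivity
  have hμ0 : 0 ≤ μ / ν := div_nonneg (by linarith) hν0.le
  have hA : ∀ᶠ N : ℕ in atTop, |((N - C N : ℕ) : ℝ) - (1 - η) * N| ≤ K := by
    have hN : Tendsto (fun N : ℕ => (1 - η) * (N:ℝ)) atTop atTop :=
      tendsto_natCast_atTop_atTop.const_mul_atTop (by linarith)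
    filter_upwards [hC', hN.eventually_ge_atTop K] with N h1 h2
    have h3 : C N ≤ N := by
      have : (C N : ℝ) ≤ N := by linarith [(abs_le.1 h1).2]
      exact_mod_cast this
    rw [Nat.cast_sub h3, ← abs_neg]
    convert h1 using 2
    ring
  have hnum := aux_key α 1 0 0 0 hα one_pos le_rfl (by ring) (fun N => N) (fun _ => 0)
    (by simp) (by simp)
  have hden := aux_key α (ν / (ν - η)) (μ / ν) η K hα ha hμ0
    (by rw [hμ]; field_simp; ring) (fun N => N - C N) C hA hC'
  have h := hnum.div hden (Real.exp_pos _).ne'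
  rw [← Real.exp_sub] at h
  have e : -(α ^ 2 * 1 ^ 2 / 2 * (1 - 0 + 0 ^ 2 * 0)) -
      -(α ^ 2 * (ν / (ν - η)) ^ 2 / 2 * (1 - η + (μ / ν) ^ 2 * η)) =
      η * (1 - η) * α ^ 2 / (2 * (ν - η) ^ 2) := by
    rw [hμ]; field_simp; ring
  rw [e] at h
  refine h.congr' ?_
  filter_upwards [eventually_gt_atTop 0] with N hN
  have hn : 0 < Real.sqrt N := Real.sqrt_pos.2 (by exact_mod_cast hN)
  have hm : 0 < (1 / Real.sqrt N) ^ (α * Real.sqrt N) * Real.Gamma (α * Real.sqrt N) :=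
    mul_pos (Real.rpow_pos_of_pos (by positivity) _) (Real.Gamma_pos_of_pos (by positivity))
  have hE : Real.exp (α * Real.sqrt N * Real.log (ν / (ν - η))) = (ν / (ν - η)) ^ (α * Real.sqrt N) := by
    rw [Real.rpow_def_of_pos ha, mul_comm]
  have hE0 : 0 < (ν / (ν - η)) ^ (α * Real.sqrt N) := Real.rpow_pos_of_pos ha _
  rw [hE]
  simp only [Pi.div_apply, pow_zero, mul_one, Real.one_rpow, one_mul]
  generalize (1 / Real.sqrt N) ^ (α * Real.sqrt N) * Real.Gamma (α * Real.sqrt N) = m at hm ⊢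
  generalize (ν / (ν - η)) ^ (α * Real.sqrt N) = E at hE0 ⊢
  generalize (∫ u in Set.Ioo (0:ℝ) (Real.sqrt N),
              (1 - u / Real.sqrt N) ^ N * u ^ (α * Real.sqrt N - 1)) = X
  generalize (∫ u in Set.Ioo (0:ℝ) (Real.sqrt N), (1 - u / Real.sqrt N) ^ (N - C N) *
                (1 + (μ / ν) * u / Real.sqrt N) ^ (C N) * u ^ (α * Real.sqrt N - 1)) = Y
  field_simp
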